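/- arXiv:2604.04763 — 2 statements merged into one kernel-verified Lean document; each statement's English description precedes it below -/
import Mathlib

section
/- In the class of groups, isomorphism of power semigroups implies isomorphism of the groups: if G₁ and G₂ are groups and the power semigroups P(G₁) and P(G₂) are isomorphic as semigroups, then G₁ and G₂ are isomorphic as groups. -/
open Pointwise

/-- The power semigroup of a group `G`: all nonempty subsets of `G` under
setwise multiplication. -/
def PowerSemigroup (G : Type*) [Group G] : Type _ := {A : Set G // A.Nonempty}

noncomputable instance (G : Type*) [Group G] : Semigroup (PowerSemigroup G) where
  mul A B := ⟨A.1 * B.1, A.2.mul B.2⟩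
  mul_assoc A B C := Subtype.ext (mul_assoc A.1 B.1 C.1)

namespace PowerSemigroup

/-- The one-element subset `{g}`. -/
def single {G : Type*} [Group G] (g : G) : PowerSemigroup G := ⟨{g}, Set.singleton_nonempty g⟩

theorem single_injective {G : Type*} [Group G] :
    Function.Injective (single : G → PowerSemigroup G) := fun _ _ h =>
  Set.singleton_injective (congrArg Subtype.val h)

theorem single_mul_single {G : Type*} [Group G] (a b : G) :
    single a * single b = single (a * b) :=
  Subtype.ext (Set.singleton_mul_singleton (a := a) (b := b))

theorem single_one_mul {G : Type*} [Group G] (A : PowerSemigroup G) : single 1 * A = A :=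
  Subtype.ext (one_mul A.1)

theorem mul_single_one {G : Type*} [Group G] (A : PowerSemigroup G) : A * single 1 = A :=
  Subtype.ext (mul_one A.1)

theorem exists_eq_single_of_mul_eq {G : Type*} [Group G] {A B : PowerSemigroup G}
    (h : A * B = single 1) : ∃ g, A = single g := by
  have h' : A.1 * B.1 = 1 := congrArg Subtype.val h
  obtain ⟨a, _, ha, _⟩ := Set.mul_eq_one_iff.mp h'
  exact ⟨a, Subtype.ext ha⟩

theorem map_single_one {G H : Type*} [Group G] [Group H]
    (e : PowerSemigroup G ≃* PowerSemigroup H) : e (single 1) = single 1 := by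
  rw [← mul_single_one (e (single 1)), ← e.apply_symm_apply (single 1), ← map_mul,
    single_one_mul]

theorem exists_map_single_eq {G H : Type*} [Group G] [Group H]
    (e : PowerSemigroup G ≃* PowerSemigroup H) (g : G) : ∃ k, e (single g) = single k := by
  apply exists_eq_single_of_mul_eq (B := e (single g⁻¹))
  rw [← map_mul, single_mul_single, mul_inv_cancel, map_single_one]

end PowerSemigroup

/-- In the class of groups, isomorphism of power semigroups implies
isomorphism of the groups. -/
theorem groups_isomorphic_of_power_semigroups_isomorphic
    {G₁ G₂ : Type*} [Group G₁] [Group G₂]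
    (h : ∃ e : PowerSemigroup G₁ → PowerSemigroup G₂,
      Function.Bijective e ∧ ∀ A B : PowerSemigroup G₁, e (A * B) = e A * e B) :
    Nonempty (G₁ ≃* G₂) := by
  obtain ⟨e₀, hb, hm⟩ := h
  let e : PowerSemigroup G₁ ≃* PowerSemigroup G₂ :=
    { Equiv.ofBijective e₀ hb with map_mul' := hm }
  choose f hf using PowerSemigroup.exists_map_single_eq e
  have hf_mul (a b : G₁) : f (a * b) = f a * f b := by
    apply PowerSemigroup.single_injective
    rw [← hf, ← PowerSemigroup.single_mul_single, map_mul, hf, hf,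
      PowerSemigroup.single_mul_single]
  refine ⟨MulEquiv.ofBijective (MonoidHom.mk' f hf_mul) ⟨fun a b hab => ?_, fun k => ?_⟩⟩
  · apply PowerSemigroup.single_injective
    apply e.injective
    rw [hf, hf]
    exact congrArg PowerSemigroup.single hab
  · obtain ⟨g, hg⟩ := PowerSemigroup.exists_map_single_eq e.symm k
    refine ⟨g, PowerSemigroup.single_injective ?_⟩
    exact (hf g).symm.trans (by rw [← hg, e.apply_symm_apply])
end

section
/- The two-element semilattice is determined by its identical inclusions up to isomorphism: every semigroup that satisfies exactly the same identical inclusions as the two-element semilattice ({0,1} with multiplication as the operation) is isomorphic to the two-element semilattice. -/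
/-- A semigroup `S` satisfies the identical inclusion `u ∈̂ V` (where `u` is a
word and `V` a set of words in the free semigroup over a countable alphabet) if
for every substitution `σ` of variables by elements of `S`, the value of `u`
equals the value of some `v ∈ V`. -/
def SatisfiesInclusion (S : Type*) [Semigroup S]
    (u : FreeSemigroup ℕ) (V : Set (FreeSemigroup ℕ)) : Prop :=
  ∀ σ : ℕ → S, ∃ v ∈ V, FreeSemigroup.lift σ u = FreeSemigroup.lift σ v

/-- The semigroup `Bool` is determined by the identities `x = x²`, `xy = yx`, the identical
inclusions `xy ∈̂ {x, y}` and `xy ∈̂ {x, yz}`, and nontriviality. -/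
theorem exists_bijective_mul_bool {S : Type*} [Semigroup S] (idem : ∀ x : S, x = x * x)
    (comm : ∀ x y : S, x * y = y * x) (sel : ∀ x y : S, x * y = x ∨ x * y = y)
    (short : ∀ x y z : S, x * y = x ∨ x * y = y * z) (nontriv : ∃ a b : S, a ≠ b) :
    ∃ e : S → Bool, Function.Bijective e ∧ ∀ x y : S, e (x * y) = e x * e y := by
  classical
  obtain ⟨z, o, hne, hzo⟩ : ∃ z o : S, z ≠ o ∧ z * o = z := by
    obtain ⟨a, b, hab⟩ := nontriv
    rcases sel a b with h | h
    · exact ⟨a, b, hab, h⟩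
    · exact ⟨b, a, hab.symm, by rw [comm, h]⟩
  have hoz : o * z = z := by rw [comm, hzo]
  have two (c : S) : c = z ∨ c = o := by
    have h₁ := short c o z
    have h₂ := sel c o
    have h₃ := short o c z
    have h₄ := short o z c
    have h₅ := comm c o
    have h₆ := comm c z
    grind
  refine ⟨fun s => decide (s = o), ⟨fun x y hxy => ?_, fun b => ?_⟩, fun x y => ?_⟩
  · rcases two x with rfl | rfl <;> rcases two y with rfl | rfl <;> grind
  · cases b
    · exact ⟨z, by simpa using hne⟩
    · exact ⟨o, decide_eq_true rfl⟩
  · have hz := (idem z).symm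
    have ho := (idem o).symm
    rcases two x with rfl | rfl <;> rcases two y with rfl | rfl <;>
      simp [hz, ho, hzo, hoz, hne] <;> rfl

/-- **Lyapin.** The two-element semilattice (here `Bool` with multiplication
`x * y = x && y`, i.e. `{0,1}` under multiplication) is determined by its
identical inclusions up to isomorphism: every semigroup satisfying exactly the
same identical inclusions as the two-element semilattice is isomorphic to it. -/
theorem two_element_semilattice_determined_by_identical_inclusions
    (S : Type*) [Semigroup S]
    (h : ∀ (u : FreeSemigroup ℕ) (V : Set (FreeSemigroup ℕ)), V.Nonempty →
      (SatisfiesInclusion S u V ↔ SatisfiesInclusion Bool u V)) :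
    ∃ e : S → Bool, Function.Bijective e ∧ ∀ x y : S, e (x * y) = e x * e y := by
  let x : FreeSemigroup ℕ := FreeSemigroup.of 0
  let y : FreeSemigroup ℕ := FreeSemigroup.of 1
  let z : FreeSemigroup ℕ := FreeSemigroup.of 2
  let subst (a b c : S) : ℕ → S := fun n => if n = 0 then a else if n = 1 then b else c
  have bool_mul_comm : ∀ a b : Bool, a * b = b * a := by decide
  have bool_idem : ∀ a : Bool, a = a * a := by decide
  have bool_sel : ∀ a b : Bool, a * b = a ∨ a * b = b := by decide
  have bool_short : ∀ a b c : Bool, a * b = a ∨ a * b = b * c := by decide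
  have idem := (h x {x * x} (by simp)).2 fun σ => by
    simpa [x] using bool_idem (σ 0)
  have comm := (h (x * y) {y * x} (by simp)).2 fun σ => by
    simpa [x, y] using bool_mul_comm (σ 0) (σ 1)
  have sel := (h (x * y) {x, y} (by simp)).2 fun σ => by
    simpa [x, y] using bool_sel (σ 0) (σ 1)
  have short := (h (x * y) {x, y * z} (by simp)).2 fun σ => by
    simpa [x, y, z] using bool_short (σ 0) (σ 1) (σ 2)
  refine exists_bijective_mul_bool
    (fun a => by simpa [x, subst] using idem (subst a a a))
    (fun a b => by simpa [x, y, subst] using comm (subst a b b))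
    (fun a b => by simpa [x, y, subst] using sel (subst a b b))
    (fun a b c => by simpa [x, y, z, subst] using short (subst a b c)) ?_
  by_contra! hS
  have triv := (h x {y} (by simp)).1 fun σ => ⟨y, rfl, hS _ _⟩
  simpa [x, y] using triv fun n => decide (n = 0)
end
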